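/- (Bers' derivative theorem, bicomplex case.) Let (F,G) and (F₁,G₁) be generating pairs on Ω, with F, G twice continuously differentiable and F₁, G₁ continuously differentiable, and suppose (F₁,G₁) is a successor of (F,G). Let W : Ω → bicomplex numbers be twice continuously differentiable and (F,G)-pseudoanalytic. Then its (F,G)-derivative Ẇ = ∂W − A_(F,G)·W − B_(F,G)·W̄ is (F₁,G₁)-pseudoanalytic, i.e. ∂̄Ẇ = a_(F₁,G₁)·Ẇ + b_(F₁,G₁)·(Ẇ)‾ on Ω. -/

import Mathlib

open MeasureTheory

/-- Bicomplex numbers: `q = q0 + q1·k` with `q0, q1 : ℂ`, `k² = -1`, `ik = ki`. -/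
structure Bicomplex : Type where
  re : ℂ
  im : ℂ

namespace Bicomplex

instance : Zero Bicomplex := ⟨⟨0, 0⟩⟩
instance : One Bicomplex := ⟨⟨1, 0⟩⟩
instance : Add Bicomplex := ⟨fun p q => ⟨p.re + q.re, p.im + q.im⟩⟩
instance : Neg Bicomplex := ⟨fun p => ⟨-p.re, -p.im⟩⟩
instance : Sub Bicomplex := ⟨fun p q => ⟨p.re - q.re, p.im - q.im⟩⟩
instance : Mul Bicomplex := ⟨fun p q => ⟨p.re * q.re - p.im * q.im, p.re * q.im + p.im * q.re⟩⟩

/-- bicomplex conjugation `q0 + q1·k ↦ q0 - q1·k` -/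
def conj (q : Bicomplex) : Bicomplex := ⟨q.re, -q.im⟩

/-- the second imaginary unit `k` -/
def k : Bicomplex := ⟨0, 1⟩

/-- embedding of ℂ into the bicomplex numbers -/
def ofC (z : ℂ) : Bicomplex := ⟨z, 0⟩

/-- bicomplex inverse: `q⁻¹ = q̄/(q0² + q1²)` (junk value if not invertible) -/
noncomputable def inv (q : Bicomplex) : Bicomplex :=
  ⟨q.re / (q.re ^ 2 + q.im ^ 2), -q.im / (q.re ^ 2 + q.im ^ 2)⟩

/-- the set 𝔖 of bicomplex zero divisors: nonzero `q` with `q·q̄ = q0² + q1² = 0` -/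
def zeroDivSet : Set Bicomplex := {q | q ≠ 0 ∧ q.re ^ 2 + q.im ^ 2 = 0}

end Bicomplex

/-- ∂/∂x of a complex-valued function on ℝ² -/
noncomputable def pdx (f : ℝ × ℝ → ℂ) (p : ℝ × ℝ) : ℂ := deriv (fun t => f (t, p.2)) p.1
/-- ∂/∂y of a complex-valued function on ℝ² -/
noncomputable def pdy (f : ℝ × ℝ → ℂ) (p : ℝ × ℝ) : ℂ := deriv (fun t => f (p.1, t)) p.2
/-- Laplacian Δ = ∂²/∂x² + ∂²/∂y² of a complex-valued function on ℝ² -/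
noncomputable def lap (f : ℝ × ℝ → ℂ) (p : ℝ × ℝ) : ℂ := pdx (pdx f) p + pdy (pdy f) p

/-- ∂/∂x of a bicomplex-valued function on ℝ² (componentwise) -/
noncomputable def bpdx (F : ℝ × ℝ → Bicomplex) (p : ℝ × ℝ) : Bicomplex :=
  ⟨pdx (fun q => (F q).re) p, pdx (fun q => (F q).im) p⟩
/-- ∂/∂y of a bicomplex-valued function on ℝ² (componentwise) -/
noncomputable def bpdy (F : ℝ × ℝ → Bicomplex) (p : ℝ × ℝ) : Bicomplex :=
  ⟨pdy (fun q => (F q).re) p, pdy (fun q => (F q).im) p⟩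

/-- `∂̄ = ∂/∂x + k·∂/∂y` -/
noncomputable def dbar (F : ℝ × ℝ → Bicomplex) (p : ℝ × ℝ) : Bicomplex :=
  bpdx F p + Bicomplex.k * bpdy F p

/-- `∂ = ∂/∂x − k·∂/∂y` -/
noncomputable def dz (F : ℝ × ℝ → Bicomplex) (p : ℝ × ℝ) : Bicomplex :=
  bpdx F p - Bicomplex.k * bpdy F p

/-- continuity of a bicomplex-valued function (componentwise) -/
def BContinuousOn (F : ℝ × ℝ → Bicomplex) (Ω : Set (ℝ × ℝ)) : Prop :=
  ContinuousOn (fun p => (F p).re) Ω ∧ ContinuousOn (fun p => (F p).im) Ω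

/-- `C^n` smoothness of a bicomplex-valued function (componentwise) -/
def BContDiffOn (n : ℕ∞) (F : ℝ × ℝ → Bicomplex) (Ω : Set (ℝ × ℝ)) : Prop :=
  ContDiffOn ℝ n (fun p => (F p).re) Ω ∧ ContDiffOn ℝ n (fun p => (F p).im) Ω

/-- characteristic coefficient `a_(F,G)` -/
noncomputable def aCoef (F G : ℝ × ℝ → Bicomplex) (z : ℝ × ℝ) : Bicomplex :=
  -((Bicomplex.conj (F z) * dbar G z - dbar F z * Bicomplex.conj (G z)) *
    Bicomplex.inv (F z * Bicomplex.conj (G z) - Bicomplex.conj (F z) * G z))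
/-- characteristic coefficient `b_(F,G)` -/
noncomputable def bCoef (F G : ℝ × ℝ → Bicomplex) (z : ℝ × ℝ) : Bicomplex :=
  (F z * dbar G z - dbar F z * G z) *
    Bicomplex.inv (F z * Bicomplex.conj (G z) - Bicomplex.conj (F z) * G z)
/-- characteristic coefficient `A_(F,G)` -/
noncomputable def ACoef (F G : ℝ × ℝ → Bicomplex) (z : ℝ × ℝ) : Bicomplex :=
  -((Bicomplex.conj (F z) * dz G z - dz F z * Bicomplex.conj (G z)) *
    Bicomplex.inv (F z * Bicomplex.conj (G z) - Bicomplex.conj (F z) * G z))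
/-- characteristic coefficient `B_(F,G)` -/
noncomputable def BCoef (F G : ℝ × ℝ → Bicomplex) (z : ℝ × ℝ) : Bicomplex :=
  (F z * dz G z - dz F z * G z) *
    Bicomplex.inv (F z * Bicomplex.conj (G z) - Bicomplex.conj (F z) * G z)

/-- `(F,G)` is a generating pair on `Ω` -/
def IsGeneratingPair (F G : ℝ × ℝ → Bicomplex) (Ω : Set (ℝ × ℝ)) : Prop :=
  BContDiffOn 1 F Ω ∧ BContDiffOn 1 G Ω ∧
    ∀ z ∈ Ω, (Bicomplex.conj (F z) * G z).im ≠ 0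

/-- `(F₁,G₁)` is a successor of `(F,G)` on Ω -/
def IsSuccessor (F G F₁ G₁ : ℝ × ℝ → Bicomplex) (Ω : Set (ℝ × ℝ)) : Prop :=
  ∀ z ∈ Ω, aCoef F₁ G₁ z = aCoef F G z ∧ bCoef F₁ G₁ z = -BCoef F G z

open Filter Topology

namespace Bicomplex

@[ext]
theorem ext {p q : Bicomplex} (hre : p.re = q.re) (him : p.im = q.im) : p = q := by
  cases p; cases q; simp_all

@[simp] theorem zero_re : (0 : Bicomplex).re = 0 := rfl
@[simp] theorem zero_im : (0 : Bicomplex).im = 0 := rfl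
@[simp] theorem one_re : (1 : Bicomplex).re = 1 := rfl
@[simp] theorem one_im : (1 : Bicomplex).im = 0 := rfl
@[simp] theorem add_re (p q : Bicomplex) : (p + q).re = p.re + q.re := rfl
@[simp] theorem add_im (p q : Bicomplex) : (p + q).im = p.im + q.im := rfl
@[simp] theorem neg_re (p : Bicomplex) : (-p).re = -p.re := rfl
@[simp] theorem neg_im (p : Bicomplex) : (-p).im = -p.im := rfl
@[simp] theorem sub_re (p q : Bicomplex) : (p - q).re = p.re - q.re := rfl
@[simp] theorem sub_im (p q : Bicomplex) : (p - q).im = p.im - q.im := rfl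
@[simp] theorem mul_re (p q : Bicomplex) : (p * q).re = p.re * q.re - p.im * q.im := rfl
@[simp] theorem mul_im (p q : Bicomplex) : (p * q).im = p.re * q.im + p.im * q.re := rfl
@[simp] theorem conj_re (p : Bicomplex) : (conj p).re = p.re := rfl
@[simp] theorem conj_im (p : Bicomplex) : (conj p).im = -p.im := rfl
@[simp] theorem k_re : k.re = 0 := rfl
@[simp] theorem k_im : k.im = 1 := rfl
@[simp] theorem ofC_re (z : ℂ) : (ofC z).re = z := rfl
@[simp] theorem ofC_im (z : ℂ) : (ofC z).im = 0 := rfl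

instance : CommRing Bicomplex where
  add_assoc p q r := by ext <;> simp <;> ring
  zero_add p := by ext <;> simp
  add_zero p := by ext <;> simp
  add_comm p q := by ext <;> simp <;> ring
  neg_add_cancel p := by ext <;> simp
  sub_eq_add_neg p q := by ext <;> simp <;> ring
  mul_assoc p q r := by ext <;> simp <;> ring
  one_mul p := by ext <;> simp
  mul_one p := by ext <;> simp
  mul_comm p q := by ext <;> simp <;> ring
  zero_mul p := by ext <;> simp
  mul_zero p := by ext <;> simp
  left_distrib p q r := by ext <;> simp <;> ring
  right_distrib p q r := by ext <;> simp <;> ring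
  nsmul := nsmulRec
  zsmul := zsmulRec

theorem conj_add (p q : Bicomplex) : conj (p + q) = conj p + conj q := by
  ext
  · simp
  · simp
    ring

theorem conj_mul (p q : Bicomplex) : conj (p * q) = conj p * conj q := by
  ext
  · simp
  · simp
    ring

theorem conj_conj (p : Bicomplex) : conj (conj p) = p := by
  ext <;> simp

theorem conj_ofC (z : ℂ) : conj (ofC z) = ofC z := by
  ext <;> simp

theorem mul_inv_of_norm_ne_zero {q : Bicomplex} (hq : q.re ^ 2 + q.im ^ 2 ≠ 0) :
    q * inv q = 1 := by
  ext
  · simp only [inv, mul_re, one_re]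
    field_simp
    ring
  · simp only [inv, mul_im, one_im]
    ring

/-- The denominator of the characteristic coefficients is invertible. -/
theorem mul_conj_sub_mul_inv {f g : Bicomplex} (h : (conj f * g).im ≠ 0) :
    (f * conj g - conj f * g) * inv (f * conj g - conj f * g) = 1 := by
  refine mul_inv_of_norm_ne_zero ?_
  have key : (f * conj g - conj f * g).re ^ 2 + (f * conj g - conj f * g).im ^ 2 =
      4 * (conj f * g).im ^ 2 := by
    simp
    ring
  rw [key]
  exact mul_ne_zero (by norm_num) (pow_ne_zero 2 h)

/-- The coordinates of `w` with respect to the basis `f, g` over `ℂ`. -/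
theorem eq_coord_mul_add_coord_mul {f g : Bicomplex} (h : (conj f * g).im ≠ 0) (w : Bicomplex) :
    w = ofC (-(conj g * w).im / (conj f * g).im) * f +
      ofC ((conj f * w).im / (conj f * g).im) * g := by
  obtain ⟨d, hd⟩ : ∃ d, d = (conj f * g).im := ⟨_, rfl⟩
  rw [← hd] at h ⊢
  simp only [mul_im, conj_re, conj_im] at hd
  ext
  · simp only [add_re, mul_re, mul_im, conj_re, conj_im, ofC_re, ofC_im]
    field_simp
    rw [hd]
    ring
  · simp only [add_im, mul_im, conj_re, conj_im, ofC_re, ofC_im]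
    field_simp
    rw [hd]
    ring

end Bicomplex

open Bicomplex

theorem pdx_eq_fderiv {f : ℝ × ℝ → ℂ} {p : ℝ × ℝ} (hf : DifferentiableAt ℝ f p) :
    pdx f p = fderiv ℝ f p (1, 0) := by
  have hline : HasDerivAt (fun t : ℝ => (t, p.2)) (1, 0) p.1 :=
    (hasDerivAt_id p.1).prodMk (hasDerivAt_const p.1 p.2)
  exact (HasFDerivAt.comp_hasDerivAt (l := f) (f := fun t : ℝ => (t, p.2)) p.1
    hf.hasFDerivAt hline).deriv

theorem pdy_eq_fderiv {f : ℝ × ℝ → ℂ} {p : ℝ × ℝ} (hf : DifferentiableAt ℝ f p) :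
    pdy f p = fderiv ℝ f p (0, 1) := by
  have hline : HasDerivAt (fun t : ℝ => (p.1, t)) (0, 1) p.2 :=
    (hasDerivAt_const p.2 p.1).prodMk (hasDerivAt_id p.2)
  exact (HasFDerivAt.comp_hasDerivAt (l := f) (f := fun t : ℝ => (p.1, t)) p.2
    hf.hasFDerivAt hline).deriv

theorem pdx_congr {f g : ℝ × ℝ → ℂ} {p : ℝ × ℝ} (h : f =ᶠ[𝓝 p] g) : pdx f p = pdx g p := by
  have hline : Tendsto (fun t : ℝ => (t, p.2)) (𝓝 p.1) (𝓝 p) :=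
    Continuous.tendsto' (by fun_prop) _ _ rfl
  exact EventuallyEq.deriv_eq (hline.eventually h)

theorem pdy_congr {f g : ℝ × ℝ → ℂ} {p : ℝ × ℝ} (h : f =ᶠ[𝓝 p] g) : pdy f p = pdy g p := by
  have hline : Tendsto (fun t : ℝ => (p.1, t)) (𝓝 p.2) (𝓝 p) :=
    Continuous.tendsto' (by fun_prop) _ _ rfl
  exact EventuallyEq.deriv_eq (hline.eventually h)

theorem eventually_differentiableAt {f : ℝ × ℝ → ℂ} {Ω : Set (ℝ × ℝ)} (hΩ : IsOpen Ω)
    (hf : ContDiffOn ℝ 2 f Ω) {p : ℝ × ℝ} (hp : p ∈ Ω) :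
    ∀ᶠ q in 𝓝 p, DifferentiableAt ℝ f q := by
  filter_upwards [hΩ.mem_nhds hp] with q hq
  exact (hf.contDiffAt (hΩ.mem_nhds hq)).differentiableAt (by norm_num)

theorem contDiffOn_pdx {f : ℝ × ℝ → ℂ} {Ω : Set (ℝ × ℝ)} (hΩ : IsOpen Ω)
    (hf : ContDiffOn ℝ 2 f Ω) : ContDiffOn ℝ 1 (pdx f) Ω :=
  ((hf.fderiv_of_isOpen hΩ (by norm_num)).clm_apply contDiffOn_const).congr fun _ hp =>
    pdx_eq_fderiv (eventually_differentiableAt hΩ hf hp).self_of_nhds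

theorem contDiffOn_pdy {f : ℝ × ℝ → ℂ} {Ω : Set (ℝ × ℝ)} (hΩ : IsOpen Ω)
    (hf : ContDiffOn ℝ 2 f Ω) : ContDiffOn ℝ 1 (pdy f) Ω :=
  ((hf.fderiv_of_isOpen hΩ (by norm_num)).clm_apply contDiffOn_const).congr fun _ hp =>
    pdy_eq_fderiv (eventually_differentiableAt hΩ hf hp).self_of_nhds

/-- Mixed partial derivatives of a `C²` function commute. -/
theorem pdx_pdy_eq_pdy_pdx {f : ℝ × ℝ → ℂ} {Ω : Set (ℝ × ℝ)} (hΩ : IsOpen Ω)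
    (hf : ContDiffOn ℝ 2 f Ω) {p : ℝ × ℝ} (hp : p ∈ Ω) : pdx (pdy f) p = pdy (pdx f) p := by
  have hev := eventually_differentiableAt hΩ hf hp
  have hd : DifferentiableAt ℝ (fderiv ℝ f) p :=
    ((hf.fderiv_of_isOpen hΩ (m := 1) (by norm_num)).contDiffAt
      (hΩ.mem_nhds hp)).differentiableAt (by norm_num)
  have hx : pdx f =ᶠ[𝓝 p] fun q => fderiv ℝ f q (1, 0) := hev.mono fun _ => pdx_eq_fderiv
  have hy : pdy f =ᶠ[𝓝 p] fun q => fderiv ℝ f q (0, 1) := hev.mono fun _ => pdy_eq_fderiv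
  have hsymm : IsSymmSndFDerivAt ℝ f p :=
    (hf.contDiffAt (hΩ.mem_nhds hp)).isSymmSndFDerivAt (by simp)
  rw [pdx_congr hy, pdy_congr hx, pdx_eq_fderiv (hd.clm_apply (differentiableAt_const _)),
    pdy_eq_fderiv (hd.clm_apply (differentiableAt_const _)),
    fderiv_clm_apply hd (differentiableAt_const _),
    fderiv_clm_apply hd (differentiableAt_const _)]
  simpa using hsymm.eq (1, 0) (0, 1)

/-- Real differentiability of a bicomplex-valued function (componentwise). -/
def BDifferentiableAt (F : ℝ × ℝ → Bicomplex) (p : ℝ × ℝ) : Prop :=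
  DifferentiableAt ℝ (fun q => (F q).re) p ∧ DifferentiableAt ℝ (fun q => (F q).im) p

theorem BContDiffOn.bDifferentiableAt {n : ℕ∞} {F : ℝ × ℝ → Bicomplex} {Ω : Set (ℝ × ℝ)}
    (hF : BContDiffOn n F Ω) (hn : n ≠ 0) (hΩ : IsOpen Ω) {p : ℝ × ℝ} (hp : p ∈ Ω) :
    BDifferentiableAt F p :=
  ⟨(hF.1.contDiffAt (hΩ.mem_nhds hp)).differentiableAt (by exact_mod_cast hn),
    (hF.2.contDiffAt (hΩ.mem_nhds hp)).differentiableAt (by exact_mod_cast hn)⟩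

theorem BContDiffOn.conj {n : ℕ∞} {F : ℝ × ℝ → Bicomplex} {Ω : Set (ℝ × ℝ)}
    (hF : BContDiffOn n F Ω) : BContDiffOn n (fun p => Bicomplex.conj (F p)) Ω :=
  ⟨hF.1, hF.2.neg⟩

theorem BContDiffOn.mul {n : ℕ∞} {F G : ℝ × ℝ → Bicomplex} {Ω : Set (ℝ × ℝ)}
    (hF : BContDiffOn n F Ω) (hG : BContDiffOn n G Ω) :
    BContDiffOn n (fun p => F p * G p) Ω :=
  ⟨(hF.1.mul hG.1).sub (hF.2.mul hG.2), (hF.1.mul hG.2).add (hF.2.mul hG.1)⟩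

theorem BContDiffOn.dbar {F : ℝ × ℝ → Bicomplex} {Ω : Set (ℝ × ℝ)}
    (hF : BContDiffOn 2 F Ω) (hΩ : IsOpen Ω) : BContDiffOn 1 (dbar F) Ω := by
  have hxre := contDiffOn_pdx hΩ hF.1
  have hyre := contDiffOn_pdy hΩ hF.1
  have hxim := contDiffOn_pdx hΩ hF.2
  have hyim := contDiffOn_pdy hΩ hF.2
  constructor
  · refine (hxre.sub hyim).congr fun p _ => ?_
    simp [_root_.dbar, bpdx, bpdy, sub_eq_add_neg]
  · refine (hxim.add hyre).congr fun p _ => ?_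
    simp [_root_.dbar, bpdx, bpdy]

theorem BContDiffOn.dz {F : ℝ × ℝ → Bicomplex} {Ω : Set (ℝ × ℝ)}
    (hF : BContDiffOn 2 F Ω) (hΩ : IsOpen Ω) : BContDiffOn 1 (dz F) Ω := by
  have hxre := contDiffOn_pdx hΩ hF.1
  have hyre := contDiffOn_pdy hΩ hF.1
  have hxim := contDiffOn_pdx hΩ hF.2
  have hyim := contDiffOn_pdy hΩ hF.2
  constructor
  · refine (hxre.add hyim).congr fun p _ => ?_
    simp [_root_.dz, bpdx, bpdy]
  · refine (hxim.sub hyre).congr fun p _ => ?_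
    simp [_root_.dz, bpdx, bpdy]

section Derivatives

variable {F G : ℝ × ℝ → Bicomplex} {p : ℝ × ℝ}

theorem bpdx_congr (h : F =ᶠ[𝓝 p] G) : bpdx F p = bpdx G p :=
  Bicomplex.ext (pdx_congr (h.fun_comp Bicomplex.re)) (pdx_congr (h.fun_comp Bicomplex.im))

theorem bpdy_congr (h : F =ᶠ[𝓝 p] G) : bpdy F p = bpdy G p :=
  Bicomplex.ext (pdy_congr (h.fun_comp Bicomplex.re)) (pdy_congr (h.fun_comp Bicomplex.im))

theorem dbar_congr (h : F =ᶠ[𝓝 p] G) : dbar F p = dbar G p := by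
  simp only [dbar, bpdx_congr h, bpdy_congr h]

theorem dz_congr (h : F =ᶠ[𝓝 p] G) : dz F p = dz G p := by
  simp only [dz, bpdx_congr h, bpdy_congr h]

theorem BDifferentiableAt.mul (hF : BDifferentiableAt F p) (hG : BDifferentiableAt G p) :
    BDifferentiableAt (fun q => F q * G q) p :=
  ⟨(hF.1.mul hG.1).sub (hF.2.mul hG.2), (hF.1.mul hG.2).add (hF.2.mul hG.1)⟩

theorem BDifferentiableAt.add (hF : BDifferentiableAt F p) (hG : BDifferentiableAt G p) :
    BDifferentiableAt (fun q => F q + G q) p :=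
  ⟨hF.1.add hG.1, hF.2.add hG.2⟩

theorem bpdx_eq_fderiv (hF : BDifferentiableAt F p) :
    bpdx F p = ⟨fderiv ℝ (fun q => (F q).re) p (1, 0), fderiv ℝ (fun q => (F q).im) p (1, 0)⟩ :=
  Bicomplex.ext (pdx_eq_fderiv hF.1) (pdx_eq_fderiv hF.2)

theorem bpdy_eq_fderiv (hF : BDifferentiableAt F p) :
    bpdy F p = ⟨fderiv ℝ (fun q => (F q).re) p (0, 1), fderiv ℝ (fun q => (F q).im) p (0, 1)⟩ :=
  Bicomplex.ext (pdy_eq_fderiv hF.1) (pdy_eq_fderiv hF.2)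

theorem bpdx_add (hF : BDifferentiableAt F p) (hG : BDifferentiableAt G p) :
    bpdx (fun q => F q + G q) p = bpdx F p + bpdx G p := by
  rw [bpdx_eq_fderiv (hF.add hG), bpdx_eq_fderiv hF, bpdx_eq_fderiv hG]
  ext
  · simp [fderiv_fun_add hF.1 hG.1]
  · simp [fderiv_fun_add hF.2 hG.2]

theorem bpdy_add (hF : BDifferentiableAt F p) (hG : BDifferentiableAt G p) :
    bpdy (fun q => F q + G q) p = bpdy F p + bpdy G p := by
  rw [bpdy_eq_fderiv (hF.add hG), bpdy_eq_fderiv hF, bpdy_eq_fderiv hG]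
  ext
  · simp [fderiv_fun_add hF.1 hG.1]
  · simp [fderiv_fun_add hF.2 hG.2]

theorem fderiv_mul_re (hF : BDifferentiableAt F p) (hG : BDifferentiableAt G p) (v : ℝ × ℝ) :
    fderiv ℝ (fun q => (F q * G q).re) p v =
      (F p).re * fderiv ℝ (fun q => (G q).re) p v + fderiv ℝ (fun q => (F q).re) p v * (G p).re -
      ((F p).im * fderiv ℝ (fun q => (G q).im) p v +
        fderiv ℝ (fun q => (F q).im) p v * (G p).im) := by
  simp only [mul_re]
  rw [fderiv_fun_sub (hF.1.fun_mul hG.1) (hF.2.fun_mul hG.2), fderiv_fun_mul hF.1 hG.1,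
    fderiv_fun_mul hF.2 hG.2]
  simp
  ring

theorem fderiv_mul_im (hF : BDifferentiableAt F p) (hG : BDifferentiableAt G p) (v : ℝ × ℝ) :
    fderiv ℝ (fun q => (F q * G q).im) p v =
      (F p).re * fderiv ℝ (fun q => (G q).im) p v + fderiv ℝ (fun q => (F q).re) p v * (G p).im +
      ((F p).im * fderiv ℝ (fun q => (G q).re) p v +
        fderiv ℝ (fun q => (F q).im) p v * (G p).re) := by
  simp only [mul_im]
  rw [fderiv_fun_add (hF.1.fun_mul hG.2) (hF.2.fun_mul hG.1), fderiv_fun_mul hF.1 hG.2,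
    fderiv_fun_mul hF.2 hG.1]
  simp
  ring

theorem bpdx_mul (hF : BDifferentiableAt F p) (hG : BDifferentiableAt G p) :
    bpdx (fun q => F q * G q) p = bpdx F p * G p + F p * bpdx G p := by
  rw [bpdx_eq_fderiv (hF.mul hG), bpdx_eq_fderiv hF, bpdx_eq_fderiv hG,
    fderiv_mul_re hF hG, fderiv_mul_im hF hG]
  ext <;> simp <;> ring

theorem bpdy_mul (hF : BDifferentiableAt F p) (hG : BDifferentiableAt G p) :
    bpdy (fun q => F q * G q) p = bpdy F p * G p + F p * bpdy G p := by
  rw [bpdy_eq_fderiv (hF.mul hG), bpdy_eq_fderiv hF, bpdy_eq_fderiv hG,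
    fderiv_mul_re hF hG, fderiv_mul_im hF hG]
  ext <;> simp <;> ring

/-- Leibniz rule for `∂̄` of a combination `φ·F + ψ·G`. -/
theorem dbar_mul_add_mul {φ ψ : ℝ × ℝ → Bicomplex} (hφ : BDifferentiableAt φ p)
    (hF : BDifferentiableAt F p) (hψ : BDifferentiableAt ψ p) (hG : BDifferentiableAt G p) :
    dbar (fun q => φ q * F q + ψ q * G q) p =
      dbar φ p * F p + φ p * dbar F p + (dbar ψ p * G p + ψ p * dbar G p) := by
  simp only [dbar, bpdx_add (hφ.mul hF) (hψ.mul hG), bpdy_add (hφ.mul hF) (hψ.mul hG),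
    bpdx_mul hφ hF, bpdx_mul hψ hG, bpdy_mul hφ hF, bpdy_mul hψ hG]
  ring

/-- Leibniz rule for `∂` of a combination `φ·F + ψ·G`. -/
theorem dz_mul_add_mul {φ ψ : ℝ × ℝ → Bicomplex} (hφ : BDifferentiableAt φ p)
    (hF : BDifferentiableAt F p) (hψ : BDifferentiableAt ψ p) (hG : BDifferentiableAt G p) :
    dz (fun q => φ q * F q + ψ q * G q) p =
      dz φ p * F p + φ p * dz F p + (dz ψ p * G p + ψ p * dz G p) := by
  simp only [dz, bpdx_add (hφ.mul hF) (hψ.mul hG), bpdy_add (hφ.mul hF) (hψ.mul hG),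
    bpdx_mul hφ hF, bpdx_mul hψ hG, bpdy_mul hφ hF, bpdy_mul hψ hG]
  ring

end Derivatives

/-- On scalar (`ℂ`-valued) functions, `∂` and `∂̄` are conjugate. -/
theorem conj_dbar_ofC (f : ℝ × ℝ → ℂ) (p : ℝ × ℝ) :
    conj (dbar (fun q => ofC (f q)) p) = dz (fun q => ofC (f q)) p := by
  ext <;> simp [dbar, dz, bpdx, bpdy, pdx, pdy]

theorem dbar_ofC (f : ℝ × ℝ → ℂ) (p : ℝ × ℝ) :
    dbar (fun q => ofC (f q)) p = ⟨pdx f p, pdy f p⟩ := by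
  ext <;> simp [dbar, bpdx, bpdy, pdx, pdy]

theorem dz_ofC (f : ℝ × ℝ → ℂ) (p : ℝ × ℝ) :
    dz (fun q => ofC (f q)) p = ⟨pdx f p, -pdy f p⟩ := by
  ext <;> simp [dz, bpdx, bpdy, pdx, pdy]

/-- On scalar `C²` functions, `∂` and `∂̄` commute. -/
theorem dz_dbar_ofC {f : ℝ × ℝ → ℂ} {Ω : Set (ℝ × ℝ)} (hΩ : IsOpen Ω)
    (hf : ContDiffOn ℝ 2 f Ω) {p : ℝ × ℝ} (hp : p ∈ Ω) :
    dz (dbar fun q => ofC (f q)) p = dbar (dz fun q => ofC (f q)) p := by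
  have hsymm := pdx_pdy_eq_pdy_pdx hΩ hf hp
  have hxneg : pdx (fun q => -pdy f q) p = -pdx (pdy f) p := deriv.fun_neg
  have hyneg : pdy (fun q => -pdy f q) p = -pdy (pdy f) p := deriv.fun_neg
  rw [show (dbar fun q => ofC (f q)) = fun q => ⟨pdx f q, pdy f q⟩ from funext (dbar_ofC f),
    show (dz fun q => ofC (f q)) = fun q => ⟨pdx f q, -pdy f q⟩ from funext (dz_ofC f)]
  ext
  · simp [dbar, dz, bpdx, bpdy, hyneg]
  · simp [dbar, dz, bpdx, bpdy, hxneg, hsymm]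

section Coefficients

variable {F G : ℝ × ℝ → Bicomplex} {z : ℝ × ℝ}

theorem dbar_eq_coef_left (h : (conj (F z) * G z).im ≠ 0) :
    dbar F z = aCoef F G z * F z + bCoef F G z * conj (F z) := by
  simp only [aCoef, bCoef]
  linear_combination (-dbar F z) * mul_conj_sub_mul_inv h

theorem dbar_eq_coef_right (h : (conj (F z) * G z).im ≠ 0) :
    dbar G z = aCoef F G z * G z + bCoef F G z * conj (G z) := by
  simp only [aCoef, bCoef]
  linear_combination (-dbar G z) * mul_conj_sub_mul_inv h

theorem dz_eq_coef_left (h : (conj (F z) * G z).im ≠ 0) :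
    dz F z = ACoef F G z * F z + BCoef F G z * conj (F z) := by
  simp only [ACoef, BCoef]
  linear_combination (-dz F z) * mul_conj_sub_mul_inv h

theorem dz_eq_coef_right (h : (conj (F z) * G z).im ≠ 0) :
    dz G z = ACoef F G z * G z + BCoef F G z * conj (G z) := by
  simp only [ACoef, BCoef]
  linear_combination (-dz G z) * mul_conj_sub_mul_inv h

end Coefficients

/-- Bers' derivative theorem, bicomplex case: if `(F₁,G₁)` is a successor
of `(F,G)` and `W` is `(F,G)`-pseudoanalytic, then the `(F,G)`-derivative
`Ẇ = ∂W − A_(F,G)W − B_(F,G)W̄` is `(F₁,G₁)`-pseudoanalytic. -/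
theorem Bers_derivative_theorem
    (Ω : Set (ℝ × ℝ)) (hΩo : IsOpen Ω)
    (F G F₁ G₁ : ℝ × ℝ → Bicomplex)
    (hFG : IsGeneratingPair F G Ω) (hFG1 : IsGeneratingPair F₁ G₁ Ω)
    (hF2 : BContDiffOn 2 F Ω) (hG2 : BContDiffOn 2 G Ω)
    (hsucc : IsSuccessor F G F₁ G₁ Ω)
    (W : ℝ × ℝ → Bicomplex) (hW : BContDiffOn 2 W Ω)
    (hpsa : ∀ z ∈ Ω, dbar W z = aCoef F G z * W z + bCoef F G z * Bicomplex.conj (W z)) :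
    ∀ z ∈ Ω,
      dbar (fun ζ => dz W ζ - ACoef F G ζ * W ζ - BCoef F G ζ * Bicomplex.conj (W ζ)) z =
        aCoef F₁ G₁ z *
            (dz W z - ACoef F G z * W z - BCoef F G z * Bicomplex.conj (W z)) +
          bCoef F₁ G₁ z *
            Bicomplex.conj
              (dz W z - ACoef F G z * W z - BCoef F G z * Bicomplex.conj (W z)) := by
  intro z hz
  rw [(hsucc z hz).1, (hsucc z hz).2]
  have hne := hFG.2.2
  -- Write `W = φ·F + ψ·G` with scalar `C²` functions `φ` and `ψ`.
  let f : ℝ × ℝ → ℂ := fun q => -(conj (G q) * W q).im / (conj (F q) * G q).im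
  let g : ℝ × ℝ → ℂ := fun q => (conj (F q) * W q).im / (conj (F q) * G q).im
  let φ : ℝ × ℝ → Bicomplex := fun q => ofC (f q)
  let ψ : ℝ × ℝ → Bicomplex := fun q => ofC (g q)
  have hf : ContDiffOn ℝ 2 f Ω :=
    ((hG2.conj.mul hW).2.neg.mul ((hF2.conj.mul hG2).2.inv hne)).congr fun _ _ => div_eq_mul_inv _ _
  have hg : ContDiffOn ℝ 2 g Ω :=
    ((hF2.conj.mul hW).2.mul ((hF2.conj.mul hG2).2.inv hne)).congr fun _ _ => div_eq_mul_inv _ _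
  have hφ : BContDiffOn 2 φ Ω := ⟨hf, contDiffOn_const⟩
  have hψ : BContDiffOn 2 ψ Ω := ⟨hg, contDiffOn_const⟩
  have hWeq : ∀ q ∈ Ω, W q = φ q * F q + ψ q * G q := fun q hq =>
    eq_coord_mul_add_coord_mul (hne q hq) (W q)
  have hWconj : ∀ q ∈ Ω, conj (W q) = φ q * conj (F q) + ψ q * conj (G q) := fun q hq => by
    rw [hWeq q hq, conj_add, conj_mul, conj_mul, conj_ofC, conj_ofC]
  have hWev : ∀ q ∈ Ω, W =ᶠ[𝓝 q] fun r => φ r * F r + ψ r * G r := fun q hq => by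
    filter_upwards [hΩo.mem_nhds hq] with r hr using hWeq r hr
  have diff : ∀ {H : ℝ × ℝ → Bicomplex}, BContDiffOn 2 H Ω → ∀ q ∈ Ω, BDifferentiableAt H q :=
    fun hH q hq => hH.bDifferentiableAt (by norm_num) hΩo hq
  have diff_one : ∀ {H : ℝ × ℝ → Bicomplex}, BContDiffOn 1 H Ω → BDifferentiableAt H z :=
    fun hH => hH.bDifferentiableAt (by norm_num) hΩo hz
  -- Pseudoanalyticity says that `∂̄φ·F + ∂̄ψ·G` vanishes.
  have hzero : ∀ q ∈ Ω, dbar φ q * F q + dbar ψ q * G q = 0 := fun q hq => by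
    have h := hpsa q hq
    rw [dbar_congr (hWev q hq), dbar_mul_add_mul (diff hφ q hq) (diff hF2 q hq) (diff hψ q hq)
      (diff hG2 q hq), hWconj q hq, hWeq q hq] at h
    linear_combination h - φ q * dbar_eq_coef_left (hne q hq) -
      ψ q * dbar_eq_coef_right (hne q hq)
  have hderiv : ∀ q ∈ Ω, dz W q - ACoef F G q * W q - BCoef F G q * conj (W q) =
      dz φ q * F q + dz ψ q * G q := fun q hq => by
    rw [dz_congr (hWev q hq), dz_mul_add_mul (diff hφ q hq) (diff hF2 q hq) (diff hψ q hq)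
      (diff hG2 q hq), hWconj q hq, hWeq q hq]
    linear_combination φ q * dz_eq_coef_left (hne q hq) + ψ q * dz_eq_coef_right (hne q hq)
  have hderiv_ev : (fun q => dz W q - ACoef F G q * W q - BCoef F G q * conj (W q)) =ᶠ[𝓝 z]
      fun q => dz φ q * F q + dz ψ q * G q := by
    filter_upwards [hΩo.mem_nhds hz] with q hq using hderiv q hq
  have hdz_zero : dz (fun q => dbar φ q * F q + dbar ψ q * G q) z = 0 := by
    have hev : (fun q => dbar φ q * F q + dbar ψ q * G q) =ᶠ[𝓝 z] fun _ => 0 := by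
      filter_upwards [hΩo.mem_nhds hz] with q hq using hzero q hq
    rw [dz_congr hev]
    ext <;> simp [dz, bpdx, bpdy, pdx, pdy]
  rw [dz_mul_add_mul (diff_one (hφ.dbar hΩo)) (diff hF2 z hz) (diff_one (hψ.dbar hΩo))
    (diff hG2 z hz), dz_dbar_ofC hΩo hf hz, dz_dbar_ofC hΩo hg hz] at hdz_zero
  have hφconj : conj (dbar φ z) = dz φ z := conj_dbar_ofC f z
  have hψconj : conj (dbar ψ z) = dz ψ z := conj_dbar_ofC g z
  have hzero_conj : dz φ z * conj (F z) + dz ψ z * conj (G z) = 0 := by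
    rw [← hφconj, ← hψconj, ← conj_mul, ← conj_mul, ← conj_add, hzero z hz]
    ext <;> simp
  rw [dbar_congr hderiv_ev, dbar_mul_add_mul (diff_one (hφ.dz hΩo)) (diff hF2 z hz)
    (diff_one (hψ.dz hΩo)) (diff hG2 z hz), hderiv z hz, conj_add, conj_mul, conj_mul,
    ← hφconj, ← hψconj, conj_conj, conj_conj, hφconj, hψconj]
  linear_combination hdz_zero + dz φ z * dbar_eq_coef_left (hne z hz) +
    dz ψ z * dbar_eq_coef_right (hne z hz) - dbar φ z * dz_eq_coef_left (hne z hz) -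
    dbar ψ z * dz_eq_coef_right (hne z hz) + bCoef F G z * hzero_conj -
    ACoef F G z * hzero z hz
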